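/- In the finite matrix MDP setup with initial distributions, suppose 0 < γ, ‖R‖_∞ ≤ Rmax, ‖Pπ - Pμ‖_op ≤ ε, ‖π₀ - μ₀‖₁ ≤ ε, and γ·ε < 1 - γ. Then for every K ≥ 0 the tail of the expansion of the RL objective converges and satisfies |∑_{k=K+1}^{∞} Lₖ| ≤ G_K, where G_K = (1/(γ(1-γ))) · (1 - γ·ε/(1-γ))⁻¹ · (γ·ε/(1-γ))^(K+1) · Rmax. -/

import Mathlib

open Matrix

/-- Sup norm of a vector. -/
noncomputable def vecSupNorm {S : Type*} [Fintype S] (v : S → ℝ) : ℝ := ⨆ s, |v s|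

/-- Maximum row ℓ1-norm of a matrix. -/
noncomputable def matOpNorm {S : Type*} [Fintype S] (A : Matrix S S ℝ) : ℝ :=
  ⨆ s, ∑ t, |A s t|

lemma aux_bound {S : Type*} [Fintype S] [Nonempty S] [DecidableEq S]
    (γ : ℝ) (hγ0 : 0 ≤ γ) (hγ1 : γ < 1) (P : Matrix S S ℝ)
    (hP0 : ∀ s t, 0 ≤ P s t) (hP1 : ∀ s, ∑ t, P s t = 1)
    (v w : S → ℝ) (B : ℝ) (h : (1 - γ • P) *ᵥ v = w) (hw : ∀ s, |w s| ≤ B) (s : S) :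
    |v s| ≤ B / (1 - γ) := by
  obtain ⟨m, hm⟩ := Finite.exists_max (fun s => |v s|)
  refine (hm s).trans ?_
  rw [le_div_iff₀ (by linarith)]
  have h1 : v m = w m + γ * ∑ t, P m t * v t := by
    have := congrFun h m
    rw [sub_mulVec, one_mulVec, smul_mulVec] at this
    simp only [Pi.sub_apply, Pi.smul_apply, smul_eq_mul, mulVec, dotProduct] at this
    linarith
  have h2 : |∑ t, P m t * v t| ≤ |v m| := by
    calc |∑ t, P m t * v t| ≤ ∑ t, |P m t * v t| := Finset.abs_sum_le_sum_abs _ _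
      _ ≤ ∑ t, P m t * |v m| := by
        refine Finset.sum_le_sum fun t _ => ?_
        rw [abs_mul, abs_of_nonneg (hP0 m t)]
        exact mul_le_mul_of_nonneg_left (hm t) (hP0 m t)
      _ = |v m| := by rw [← Finset.sum_mul, hP1, one_mul]
  have h3 : |v m| ≤ |w m| + γ * |v m| := by
    calc |v m| = |w m + γ * ∑ t, P m t * v t| := by rw [← h1]
      _ ≤ |w m| + |γ * ∑ t, P m t * v t| := abs_add_le _ _
      _ ≤ _ := by
        rw [abs_mul, abs_of_nonneg hγ0]
        gcongr
  have := hw m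
  linarith

lemma aux_inv {S : Type*} [Fintype S] [Nonempty S] [DecidableEq S]
    (γ : ℝ) (hγ0 : 0 ≤ γ) (hγ1 : γ < 1) (P : Matrix S S ℝ)
    (hP0 : ∀ s t, 0 ≤ P s t) (hP1 : ∀ s, ∑ t, P s t = 1)
    (w : S → ℝ) (B : ℝ) (hw : ∀ s, |w s| ≤ B) (s : S) :
    |((1 - γ • P)⁻¹ *ᵥ w) s| ≤ B / (1 - γ) := by
  have hu : IsUnit (1 - γ • P) := by
    rw [← Matrix.mulVec_injective_iff_isUnit]
    intro x y hxy
    have h0 : (1 - γ • P) *ᵥ (x - y) = 0 := by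
      rw [mulVec_sub]; exact sub_eq_zero.mpr hxy
    ext t
    have := aux_bound γ hγ0 hγ1 P hP0 hP1 (x - y) 0 0 h0 (by simp) t
    rw [zero_div] at this
    have := abs_nonpos_iff.mp this
    simp only [Pi.sub_apply] at this
    linarith
  refine aux_bound γ hγ0 hγ1 P hP0 hP1 _ w B ?_ hw s
  rw [mulVec_mulVec, Matrix.mul_nonsing_inv _ ((Matrix.isUnit_iff_isUnit_det _).mp hu), one_mulVec]

lemma aux_dot {S : Type*} [Fintype S] (a v : S → ℝ) (A B : ℝ) (hB : 0 ≤ B)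
    (ha : ∑ s, |a s| ≤ A) (hv : ∀ s, |v s| ≤ B) : |a ⬝ᵥ v| ≤ A * B := by
  calc |a ⬝ᵥ v| ≤ ∑ t, |a t * v t| := Finset.abs_sum_le_sum_abs _ _
    _ ≤ ∑ t, |a t| * B := by
      refine Finset.sum_le_sum fun t _ => ?_
      rw [abs_mul]
      exact mul_le_mul_of_nonneg_left (hv t) (abs_nonneg _)
    _ = (∑ t, |a t|) * B := by rw [Finset.sum_mul]
    _ ≤ A * B := mul_le_mul_of_nonneg_right ha hB

/-- **Tail bound of the expansion of the RL objective.**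
Under `0 < γ`, `‖R‖_∞ ≤ Rmax`, `‖Pπ - Pμ‖_op ≤ ε`, `‖π₀ - μ₀‖₁ ≤ ε`, `γ·ε < 1 - γ`,
the tail `∑_{k=K+1}^∞ Lₖ` converges and `|∑_{k=K+1}^∞ Lₖ| ≤ G_K`. -/
theorem stmt_10 {S : Type*} [Fintype S] [Nonempty S] [DecidableEq S]
    (γ : ℝ) (hγ0 : 0 ≤ γ) (hγ1 : γ < 1) (hγpos : 0 < γ)
    (Pπ Pμ : Matrix S S ℝ)
    (hPπ0 : ∀ s t, 0 ≤ Pπ s t) (hPπ1 : ∀ s, ∑ t, Pπ s t = 1)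
    (hPμ0 : ∀ s t, 0 ≤ Pμ s t) (hPμ1 : ∀ s, ∑ t, Pμ s t = 1)
    (R : S → ℝ) (Qμ : S → ℝ) (hQμ : Qμ = (1 - γ • Pμ)⁻¹ *ᵥ R)
    (M : Matrix S S ℝ) (hM : M = γ • ((1 - γ • Pμ)⁻¹ * (Pπ - Pμ)))
    (π₀ μ₀ : S → ℝ)
    (hπ₀0 : ∀ s, 0 ≤ π₀ s) (hπ₀1 : ∑ s, π₀ s = 1)
    (hμ₀0 : ∀ s, 0 ≤ μ₀ s) (hμ₀1 : ∑ s, μ₀ s = 1)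
    (L : ℕ → ℝ)
    (hL1 : L 1 = (π₀ - μ₀) ⬝ᵥ Qμ + μ₀ ⬝ᵥ ((M ^ 1) *ᵥ Qμ))
    (hLk : ∀ k : ℕ, 2 ≤ k →
      L k = (π₀ - μ₀) ⬝ᵥ ((M ^ (k - 1)) *ᵥ Qμ) + μ₀ ⬝ᵥ ((M ^ k) *ᵥ Qμ))
    (Rmax ε : ℝ) (hR : vecSupNorm R ≤ Rmax) (hε : matOpNorm (Pπ - Pμ) ≤ ε)
    (hinit : ∑ s, |π₀ s - μ₀ s| ≤ ε)
    (hsmall : γ * ε < 1 - γ) (K : ℕ) :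
    (Summable fun k : ℕ => L (K + 1 + k)) ∧
      |∑' k : ℕ, L (K + 1 + k)| ≤
        (1 / (γ * (1 - γ))) * (1 - γ * ε / (1 - γ))⁻¹ * (γ * ε / (1 - γ)) ^ (K + 1) * Rmax := by
  have hg : 0 < 1 - γ := by linarith
  have hε0 : 0 ≤ ε := (Finset.sum_nonneg fun s _ => abs_nonneg _).trans hinit
  have hRs : ∀ s, |R s| ≤ Rmax := fun s =>
    (le_ciSup (f := fun s => |R s|) (Set.finite_range _).bddAbove s).trans hR
  have hPs : ∀ s, ∑ t, |(Pπ - Pμ) s t| ≤ ε := fun s =>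
    (le_ciSup (f := fun s => ∑ t, |(Pπ - Pμ) s t|) (Set.finite_range _).bddAbove s).trans hε
  have hRm : 0 ≤ Rmax := (abs_nonneg _).trans (hRs (Classical.arbitrary S))
  set x := γ * ε / (1 - γ) with hx
  have hx0 : 0 ≤ x := by positivity
  have hx1 : x < 1 := by rw [hx, div_lt_one hg]; exact hsmall
  have hU : ∀ k : ℕ, ∀ s, |((M ^ k) *ᵥ Qμ) s| ≤ x ^ k * (Rmax / (1 - γ)) := by
    intro k
    induction k with
    | zero =>
      intro s
      rw [pow_zero, one_mulVec, pow_zero, one_mul, hQμ]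
      exact aux_inv γ hγ0 hγ1 Pμ hPμ0 hPμ1 R Rmax hRs s
    | succ k ih =>
      intro s
      have hB : 0 ≤ x ^ k * (Rmax / (1 - γ)) := by positivity
      have h1 : ∀ s, |((Pπ - Pμ) *ᵥ ((M ^ k) *ᵥ Qμ)) s| ≤ ε * (x ^ k * (Rmax / (1 - γ))) :=
        fun s => aux_dot _ _ _ _ hB (hPs s) ih
      have h2 := aux_inv γ hγ0 hγ1 Pμ hPμ0 hPμ1 _ _ h1 s
      have h3 : (M ^ (k + 1)) *ᵥ Qμ
          = γ • ((1 - γ • Pμ)⁻¹ *ᵥ ((Pπ - Pμ) *ᵥ ((M ^ k) *ᵥ Qμ))) := by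
        rw [pow_succ', ← mulVec_mulVec]
        generalize (M ^ k) *ᵥ Qμ = z
        rw [hM, smul_mulVec, mulVec_mulVec]
      rw [h3, Pi.smul_apply, smul_eq_mul, abs_mul, abs_of_nonneg hγ0]
      refine (mul_le_mul_of_nonneg_left h2 hγ0).trans (le_of_eq ?_)
      rw [pow_succ, hx]
      ring
  have hL : ∀ k : ℕ, |L (k + 1)| ≤ x ^ (k + 1) * (Rmax / (γ * (1 - γ))) := by
    intro k
    have e : L (k + 1) = (π₀ - μ₀) ⬝ᵥ ((M ^ k) *ᵥ Qμ) + μ₀ ⬝ᵥ ((M ^ (k + 1)) *ᵥ Qμ) := by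
      cases k with
      | zero => simpa using hL1
      | succ k => exact hLk (k + 1 + 1) (by omega)
    have h1 := aux_dot (π₀ - μ₀) _ ε _ (by positivity) hinit (hU k)
    have h2 := aux_dot μ₀ _ 1 _ (by positivity)
      (by simp only [abs_of_nonneg (hμ₀0 _)]; exact hμ₀1.le) (hU (k + 1))
    rw [e]
    refine (abs_add_le _ _).trans ((add_le_add h1 h2).trans (le_of_eq ?_))
    have hex : ε = x * (1 - γ) / γ := by rw [hx]; field_simp
    rw [hex, pow_succ]
    field_simp
    ring
  have hb : ∀ k : ℕ, ‖L (K + 1 + k)‖ ≤ (x ^ (K + 1) * (Rmax / (γ * (1 - γ)))) * x ^ k := by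
    intro k
    have := hL (K + k)
    rw [show K + k + 1 = K + 1 + k by ring] at this
    rw [Real.norm_eq_abs]
    refine this.trans (le_of_eq ?_)
    rw [pow_add]; ring
  have hs := (hasSum_geometric_of_lt_one hx0 hx1).mul_left (x ^ (K + 1) * (Rmax / (γ * (1 - γ))))
  refine ⟨Summable.of_norm_bounded hs.summable hb, ?_⟩
  have := tsum_of_norm_bounded hs hb
  rw [Real.norm_eq_abs] at this
  refine this.trans (le_of_eq ?_)
  ring
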